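/- Let 1 ≤ p₁ < 2 < p₂ ≤ ∞ with (p₁, p₂) ≠ (1, ∞), and set t = min(p₁′, p₂). Then there is a constant C > 0, independent of N and k, such that for all N, k ∈ ℕ: a_k(id : ℓ_{p₁}^N → ℓ_{p₂}^N) ≤ C if k ≤ N^{2/t}; a_k(id : ℓ_{p₁}^N → ℓ_{p₂}^N) ≤ C · N^{1/t} k^{−1/2} if N^{2/t} < k ≤ N; and a_k(id : ℓ_{p₁}^N → ℓ_{p₂}^N) = 0 if k > N. -/

import Mathlib

open scoped ENNReal

/-- The `k`-th approximation number of a continuous linear operator `T : X → Y`. -/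
noncomputable def approxNumber {X Y : Type*} [NormedAddCommGroup X] [NormedSpace ℂ X]
    [NormedAddCommGroup Y] [NormedSpace ℂ Y] (T : X →L[ℂ] Y) (k : ℕ) : ℝ :=
  sInf { r | ∃ A : X →L[ℂ] Y,
    Module.rank ℂ (LinearMap.range (A : X →ₗ[ℂ] Y)) < (k : Cardinal) ∧ r = ‖T - A‖ }

/-- The identity operator `id : ℓ_{p₁}^N → ℓ_{p₂}^N` on `ℂ^N`. -/
noncomputable def lpId (p₁ p₂ : ℝ≥0∞) [Fact (1 ≤ p₁)] [Fact (1 ≤ p₂)] (N : ℕ) :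
    PiLp p₁ (fun _ : Fin N => ℂ) →L[ℂ] PiLp p₂ (fun _ : Fin N => ℂ) :=
  LinearMap.toContinuousLinearMap
    (((WithLp.linearEquiv p₂ ℂ (Fin N → ℂ)).symm.toLinearMap).comp
      (WithLp.linearEquiv p₁ ℂ (Fin N → ℂ)).toLinearMap)

/-- The conjugate exponent `p′` of `p ∈ [1, ∞]`, characterized by `1/p + 1/p′ = 1`. -/
noncomputable def conjExp (p : ℝ≥0∞) : ℝ≥0∞ := (1 - p⁻¹)⁻¹


/-- The Laplace transform bound for Rademacher sums. -/
theorem sum_exp_sign_le {ι : Type*} [Fintype ι] [DecidableEq ι] (c : ι → ℝ) :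
    ∑ δ : ι → ℤˣ, Real.exp (∑ i, ((δ i : ℤ) : ℝ) * c i) ≤
      Fintype.card (ι → ℤˣ) * Real.exp ((∑ i, c i ^ 2) / 2) := by
  have key : ∀ i, ∑ u : ℤˣ, Real.exp (((u : ℤ) : ℝ) * c i) ≤ 2 * Real.exp (c i ^ 2 / 2) := by
    intro i
    have h := Real.cosh_le_exp_half_sq (c i)
    rw [Real.cosh_eq] at h
    have hu : (Finset.univ : Finset ℤˣ) = {1, -1} := rfl
    rw [hu, Finset.sum_pair (by decide)]
    simp only [Units.val_one, Int.cast_one, one_mul, Units.val_neg, Int.cast_neg, neg_mul]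
    linarith
  calc ∑ δ : ι → ℤˣ, Real.exp (∑ i, ((δ i : ℤ) : ℝ) * c i)
      = ∏ i, ∑ u : ℤˣ, Real.exp (((u : ℤ) : ℝ) * c i) := by
        rw [Fintype.prod_sum]
        exact Finset.sum_congr rfl fun δ _ => Real.exp_sum _ _
    _ ≤ ∏ i, (2 * Real.exp (c i ^ 2 / 2)) :=
        Finset.prod_le_prod (fun i _ => Finset.sum_nonneg fun u _ => (Real.exp_pos _).le)
          fun i _ => key i
    _ = _ := by
        rw [Finset.prod_mul_distrib, ← Real.exp_sum, Finset.sum_div]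
        simp

/-- Matrices of signs. -/
abbrev SignMatrix (N m : ℕ) := Fin N × Fin m → ℤˣ

/-- Conditional version: the coefficients may depend on the signs in the rows outside `A`. -/
theorem sum_exp_sign_rows_le {N m : ℕ} (A : Finset (Fin N))
    (w : (SignMatrix N m) → Fin m → ℝ)
    (hw : ∀ ε δ : SignMatrix N m, (∀ i ∉ A, ∀ k, ε (i, k) = δ (i, k)) → w ε = w δ)
    (hw1 : ∀ ε, ∑ k, w ε k ^ 2 ≤ 1) (a : ℝ) :
    ∑ ε : SignMatrix N m, Real.exp (a * ∑ i ∈ A, ∑ k, ((ε (i, k) : ℤ) : ℝ) * w ε k) ≤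
      Fintype.card (SignMatrix N m) * Real.exp (a ^ 2 * A.card / 2) := by
  set f : SignMatrix N m → ℝ := fun ε =>
    Real.exp (a * ∑ i ∈ A, ∑ k, ((ε (i, k) : ℤ) : ℝ) * w ε k) with hf
  let r : SignMatrix N m → SignMatrix N m := fun δ x => if x.1 ∈ A then δ x else 1
  have hinv : ∀ δ, ∑ ε, f (r δ * ε) = ∑ ε, f ε := fun δ => Equiv.sum_comp (Equiv.mulLeft (r δ)) f
  have hfr : ∀ ε δ, f (r δ * ε) = Real.exp (∑ x : Fin N × Fin m, ((δ x : ℤ) : ℝ) *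
      (if x.1 ∈ A then a * ((ε x : ℤ) : ℝ) * w ε x.2 else 0)) := by
    intro ε δ
    have hww : w (r δ * ε) = w ε := by
      apply hw
      intro i hi k
      simp [r, hi]
    simp only [hf, hww]
    congr 1
    rw [Fintype.sum_prod_type, Finset.mul_sum,
      ← Finset.sum_filter_add_sum_filter_not Finset.univ (· ∈ A)]
    rw [Finset.sum_eq_zero (s := Finset.univ.filter (· ∉ A)), add_zero]
    · rw [Finset.filter_mem_eq_inter, Finset.univ_inter]
      refine Finset.sum_congr rfl fun i hi => ?_
      rw [Finset.mul_sum]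
      refine Finset.sum_congr rfl fun k _ => ?_
      simp only [r, hi, Pi.mul_apply, if_true, Units.val_mul, Int.cast_mul]
      ring
    · intro i hi
      simp at hi
      simp [hi]
  have hpos : (0 : ℝ) < Fintype.card (SignMatrix N m) := by exact_mod_cast Fintype.card_pos
  have h1 : Fintype.card (SignMatrix N m) * ∑ ε, f ε = ∑ ε, ∑ δ, f (r δ * ε) := by
    rw [Finset.sum_comm, Finset.sum_congr rfl fun δ _ => hinv δ]
    simp
  have hsq : ∀ u : ℤˣ, (((u : ℤ) : ℝ)) ^ 2 = 1 := by
    intro u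
    rcases Int.units_eq_one_or u with h | h <;> simp [h]
  have h2 : ∀ ε, ∑ δ, f (r δ * ε) ≤
      Fintype.card (SignMatrix N m) * Real.exp (a ^ 2 * A.card / 2) := by
    intro ε
    rw [Finset.sum_congr rfl fun δ _ => hfr ε δ]
    refine (sum_exp_sign_le _).trans ?_
    refine mul_le_mul_of_nonneg_left (Real.exp_le_exp.2 ?_) hpos.le
    have : ∑ x : Fin N × Fin m, (if x.1 ∈ A then a * ((ε x : ℤ) : ℝ) * w ε x.2 else 0) ^ 2
        = ∑ i : Fin N, if i ∈ A then a ^ 2 * ∑ k, w ε k ^ 2 else 0 := by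
      rw [Fintype.sum_prod_type]
      refine Finset.sum_congr rfl fun i _ => ?_
      split_ifs with hi
      · rw [Finset.mul_sum]
        refine Finset.sum_congr rfl fun k _ => ?_
        rw [mul_pow, mul_pow, hsq, mul_one]
      · simp
    rw [this, Finset.sum_ite_mem, Finset.univ_inter, Finset.sum_const, nsmul_eq_mul]
    have := mul_le_mul_of_nonneg_left (hw1 ε)
      (mul_nonneg (Nat.cast_nonneg (α := ℝ) A.card) (sq_nonneg a))
    linarith
  have h3 : Fintype.card (SignMatrix N m) * ∑ ε, f ε ≤
      Fintype.card (SignMatrix N m) *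
        (Fintype.card (SignMatrix N m) * Real.exp (a ^ 2 * A.card / 2)) := by
    rw [h1]
    refine (Finset.sum_le_sum fun ε _ => h2 ε).trans ?_
    simp
  exact le_of_mul_le_mul_left h3 hpos

/-- A bound for the logarithm of the number of `s`-element subsets of an `N`-element set. -/
noncomputable def entropyBound (θ : ℝ) (N s : ℕ) : ℝ :=
  (4 + 1 / θ) * (s : ℝ) ^ (1 - θ) * (N : ℝ) ^ θ

theorem entropyBound_nonneg {θ : ℝ} (hθ : 0 < θ) (N s : ℕ) : 0 ≤ entropyBound θ N s := by
  unfold entropyBound; positivity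

theorem entropyBound_pos {θ : ℝ} (hθ : 0 < θ) {N s : ℕ} (hN : 0 < N) (hs : 0 < s) :
    0 < entropyBound θ N s := by
  unfold entropyBound; positivity

theorem entropyBound_mono {θ : ℝ} (hθ : 0 < θ) (hθ1 : θ ≤ 1) (N : ℕ) {r s : ℕ} (h : r ≤ s) :
    entropyBound θ N r ≤ entropyBound θ N s := by
  unfold entropyBound
  have : (r : ℝ) ^ (1 - θ) ≤ (s : ℝ) ^ (1 - θ) :=
    Real.rpow_le_rpow (by positivity) (by exact_mod_cast h) (by linarith)
  gcongr

theorem choose_mul_exp_neg_entropyBound_le {θ : ℝ} (hθ : 0 < θ) {N s : ℕ} (hs : 0 < s)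
    (hsN : s ≤ N) : (N.choose s : ℝ) * Real.exp (-entropyBound θ N s) ≤ (1 / 4) ^ s := by
  have hs' : (0 : ℝ) < s := by exact_mod_cast hs
  have hN' : (0 : ℝ) < N := by exact_mod_cast hs.trans_le hsN
  have hx1 : (1 : ℝ) ≤ N / s := by
    rw [le_div_iff₀ hs', one_mul]; exact_mod_cast hsN
  have hx0 : (0 : ℝ) < N / s := by positivity
  have hL : entropyBound θ N s = (4 + 1 / θ) * s * ((N : ℝ) / s) ^ θ := by
    unfold entropyBound
    rw [Real.div_rpow hN'.le hs'.le, Real.rpow_sub hs', Real.rpow_one]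
    field_simp
  have hlow : (s : ℝ) * (4 + Real.log (N / s)) ≤ entropyBound θ N s := by
    rw [hL]
    have h1 := Real.log_le_rpow_div hx0.le hθ
    have h2 : 1 ≤ ((N : ℝ) / s) ^ θ := Real.one_le_rpow hx1 hθ.le
    have : 4 + Real.log (N / s) ≤ (4 + 1 / θ) * ((N : ℝ) / s) ^ θ := by
      rw [add_mul, one_div, inv_mul_eq_div]; linarith
    nlinarith
  have hchoose : (N.choose s : ℝ) ≤ Real.exp (s * (1 + Real.log (N / s))) := by
    have h1 : (N.choose s : ℝ) ≤ (N : ℝ) ^ s / s.factorial := Nat.choose_le_pow_div s N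
    have h2 := Real.pow_div_factorial_le_exp (s : ℝ) hs'.le s
    have h3 : (N : ℝ) ^ s / s.factorial = (s : ℝ) ^ s / s.factorial * (N / s) ^ s := by
      rw [div_pow]; field_simp
    rw [h3] at h1
    refine h1.trans ?_
    rw [mul_add, Real.exp_add, mul_one, Real.exp_nat_mul (Real.log _), Real.exp_log hx0]
    gcongr
  calc (N.choose s : ℝ) * Real.exp (-entropyBound θ N s)
      ≤ Real.exp (s * (1 + Real.log (N / s))) * Real.exp (-entropyBound θ N s) := by gcongr
    _ ≤ Real.exp (s * (-3)) := by
        rw [← Real.exp_add]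
        apply Real.exp_le_exp.2
        linarith
    _ = (Real.exp (-3)) ^ s := Real.exp_nat_mul _ _
    _ ≤ (1 / 4) ^ s := by
        gcongr
        rw [Real.exp_neg, one_div]
        gcongr
        have := Real.add_one_le_exp (3 : ℝ)
        linarith

theorem sum_exp_neg_entropyBound_le {θ : ℝ} (hθ : 0 < θ) (N : ℕ) :
    ∑ A : Finset (Fin N) with A.Nonempty, Real.exp (-entropyBound θ N A.card) ≤ 1 / 3 := by
  have h1 : ∑ A : Finset (Fin N) with A.Nonempty, Real.exp (-entropyBound θ N A.card) =
      ∑ A : Finset (Fin N), (fun s : ℕ => if s = 0 then (0 : ℝ) else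
        Real.exp (-entropyBound θ N s)) A.card := by
    rw [Finset.sum_filter]
    refine Finset.sum_congr rfl fun A _ => ?_
    rcases A.eq_empty_or_nonempty with h | h
    · simp [h]
    · simp [h, h.ne_empty]
  rw [h1, ← Finset.powerset_univ, Finset.sum_powerset_apply_card (fun s : ℕ => if s = 0 then (0 : ℝ) else
        Real.exp (-entropyBound θ N s)), Finset.card_univ,
    Fintype.card_fin, Finset.sum_range_succ']
  have h2 : ∀ s ∈ Finset.range N, N.choose (s + 1) • (if s + 1 = 0 then (0 : ℝ) else
        Real.exp (-entropyBound θ N (s + 1))) ≤ (1 / 4) * (1 / 4 : ℝ) ^ s := by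
    intro s hs
    rw [if_neg (by omega), nsmul_eq_mul]
    refine (choose_mul_exp_neg_entropyBound_le hθ (by omega) ?_).trans_eq ?_
    · have := Finset.mem_range.1 hs
      omega
    · rw [pow_succ]; ring
  refine (add_le_add_left (Finset.sum_le_sum h2) _).trans ?_
  rw [← Finset.mul_sum, geom_sum_eq (by norm_num)]
  have hpow : (0 : ℝ) ≤ (1 / 4) ^ N := by positivity
  generalize (1 / 4 : ℝ) ^ N = y at hpow ⊢
  norm_num
  linarith

/-- The sum of the rows of `ε` with index in `B`. -/
def rowSum {N m : ℕ} (ε : SignMatrix N m) (B : Finset (Fin N)) (k : Fin m) : ℝ :=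
  ∑ i ∈ B, ((ε (i, k) : ℤ) : ℝ)

/-- The Gram matrix of the rows of `ε`. -/
def gram {N m : ℕ} (ε : SignMatrix N m) (i l : Fin N) : ℝ :=
  ∑ k, ((ε (i, k) : ℤ) : ℝ) * ((ε (l, k) : ℤ) : ℝ)

theorem gram_comm {N m : ℕ} (ε : SignMatrix N m) (i l : Fin N) : gram ε i l = gram ε l i := by
  simp [gram, mul_comm]

theorem gram_self {N m : ℕ} (ε : SignMatrix N m) (i : Fin N) : gram ε i i = m := by
  have h : ∀ u : ℤˣ, ((u : ℤ) : ℝ) * ((u : ℤ) : ℝ) = 1 := by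
    intro u
    rcases Int.units_eq_one_or u with h | h <;> simp [h]
  simp [gram, h]

theorem sum_gram {N m : ℕ} (ε : SignMatrix N m) (A B : Finset (Fin N)) :
    ∑ i ∈ A, ∑ l ∈ B, gram ε i l = ∑ i ∈ A, ∑ k, ((ε (i, k) : ℤ) : ℝ) * rowSum ε B k := by
  refine Finset.sum_congr rfl fun i _ => ?_
  simp only [gram, rowSum, Finset.mul_sum]
  exact Finset.sum_comm

theorem sum_gram_self {N m : ℕ} (ε : SignMatrix N m) (B : Finset (Fin N)) :
    ∑ i ∈ B, ∑ l ∈ B, gram ε i l = ∑ k, rowSum ε B k ^ 2 := by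
  rw [sum_gram, Finset.sum_comm]
  refine Finset.sum_congr rfl fun k _ => ?_
  rw [← Finset.sum_mul, sq]
  rfl

theorem exists_forall_lt_one_of_sum_lt {Ω ι : Type*} [Fintype Ω] (P : Finset ι) (T : ι → Ω → ℝ)
    (hT : ∀ p ε, 0 ≤ T p ε) (h : ∑ ε, ∑ p ∈ P, T p ε < ∑ _ε : Ω, (1 : ℝ)) :
    ∃ ε, ∀ p ∈ P, T p ε < 1 := by
  obtain ⟨ε, -, hε⟩ := Finset.exists_lt_of_sum_lt h
  exact ⟨ε, fun p hp =>
    (Finset.single_le_sum (f := fun p => T p ε) (fun p _ => hT p ε) hp).trans_lt hε⟩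

theorem exists_signMatrix_exp {θ : ℝ} (hθ : 0 < θ) (hθ1 : θ ≤ 1) (N m : ℕ) :
    ∃ ε : SignMatrix N m, ∀ A B : Finset (Fin N), Disjoint A B → A.Nonempty → B.Nonempty →
      B.card ≤ A.card →
      (Real.exp (2 * √(entropyBound θ N A.card / A.card) * (∑ i ∈ A, ∑ k, ((ε (i, k) : ℤ) : ℝ) *
          (rowSum ε B k / √(∑ k, rowSum ε B k ^ 2)))) +
        Real.exp (-(2 * √(entropyBound θ N A.card / A.card)) * (∑ i ∈ A, ∑ k, ((ε (i, k) : ℤ) : ℝ) *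
          (rowSum ε B k / √(∑ k, rowSum ε B k ^ 2))))) *
        Real.exp (-4 * entropyBound θ N A.card) < 1 := by
  let R : Finset (Fin N) → SignMatrix N m → ℝ := fun B ε => √(∑ k, rowSum ε B k ^ 2)
  let w : Finset (Fin N) → SignMatrix N m → Fin m → ℝ := fun B ε k => rowSum ε B k / R B ε
  let a : Finset (Fin N) → ℝ := fun A => 2 * √(entropyBound θ N A.card / A.card)
  let S : Finset (Fin N) → Finset (Fin N) → SignMatrix N m → ℝ := fun A B ε =>
    ∑ i ∈ A, ∑ k, ((ε (i, k) : ℤ) : ℝ) * w B ε k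
  let T : Finset (Fin N) → Finset (Fin N) → SignMatrix N m → ℝ := fun A B ε =>
    (Real.exp (a A * S A B ε) + Real.exp (-a A * S A B ε)) *
      Real.exp (-4 * entropyBound θ N A.card)
  let Q : Finset (Finset (Fin N)) := Finset.univ.filter Finset.Nonempty
  let P : Finset (Finset (Fin N) × Finset (Fin N)) :=
    (Q ×ˢ Q).filter fun p => Disjoint p.1 p.2 ∧ p.2.card ≤ p.1.card
  set c : ℝ := (Fintype.card (SignMatrix N m) : ℝ) with hc
  have hcpos : 0 < c := by
    rw [hc]
    exact_mod_cast Fintype.card_pos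
  have hTnn : ∀ A B ε, 0 ≤ T A B ε := fun A B ε => by positivity
  have hT : ∀ p ∈ P, ∑ ε, T p.1 p.2 ε ≤ 2 * c *
      (Real.exp (-entropyBound θ N p.1.card) * Real.exp (-entropyBound θ N p.2.card)) := by
    rintro ⟨A, B⟩ hp
    simp only [P, Q, Finset.mem_filter, Finset.mem_product, Finset.mem_univ, true_and] at hp
    obtain ⟨⟨hA, hB⟩, hAB, hcard⟩ := hp
    have hAc : (0 : ℝ) < A.card := by exact_mod_cast hA.card_pos
    have hw : ∀ ε δ : SignMatrix N m, (∀ i ∉ A, ∀ k, ε (i, k) = δ (i, k)) → w B ε = w B δ := by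
      intro ε δ h
      have h' : rowSum ε B = rowSum δ B := by
        funext k
        refine Finset.sum_congr rfl fun i hi => ?_
        rw [h i (Finset.disjoint_right.1 hAB hi)]
      simp only [w, R, h']
    have hw1 : ∀ ε, ∑ k, w B ε k ^ 2 ≤ 1 := by
      intro ε
      simp only [w, R, div_pow]
      rw [← Finset.sum_div, Real.sq_sqrt (Finset.sum_nonneg fun k _ => sq_nonneg _)]
      exact div_self_le_one _
    have ha : a A ^ 2 * A.card / 2 = 2 * entropyBound θ N A.card := by
      simp only [a]
      rw [mul_pow, Real.sq_sqrt (div_nonneg (entropyBound_nonneg hθ _ _) hAc.le)]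
      field_simp
    have h1 := sum_exp_sign_rows_le A (w B) hw hw1 (a A)
    have h2 := sum_exp_sign_rows_le A (w B) hw hw1 (-a A)
    rw [neg_sq, ha] at h2
    rw [ha] at h1
    have hmono := entropyBound_mono hθ hθ1 N hcard
    calc ∑ ε, T A B ε
        = (∑ ε, Real.exp (a A * S A B ε) + ∑ ε, Real.exp (-a A * S A B ε)) *
            Real.exp (-4 * entropyBound θ N A.card) := by
          rw [← Finset.sum_add_distrib, Finset.sum_mul]
      _ ≤ (c * Real.exp (2 * entropyBound θ N A.card) +
            c * Real.exp (2 * entropyBound θ N A.card)) *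
            Real.exp (-4 * entropyBound θ N A.card) :=
          mul_le_mul_of_nonneg_right (add_le_add h1 h2) (Real.exp_pos _).le
      _ = 2 * c * Real.exp (-2 * entropyBound θ N A.card) := by
          rw [← two_mul, ← mul_assoc, mul_assoc, ← Real.exp_add]
          ring_nf
      _ ≤ _ := by
          rw [← Real.exp_add]
          gcongr
          linarith
  have hsum : ∑ ε, ∑ p ∈ P, T p.1 p.2 ε < ∑ _ε : SignMatrix N m, (1 : ℝ) := by
    rw [Finset.sum_comm]
    have hE := sum_exp_neg_entropyBound_le hθ N
    have hE0 : 0 ≤ ∑ A ∈ Q, Real.exp (-entropyBound θ N A.card) :=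
      Finset.sum_nonneg fun _ _ => (Real.exp_pos _).le
    calc ∑ p ∈ P, ∑ ε, T p.1 p.2 ε
        ≤ ∑ p ∈ P, 2 * c *
          (Real.exp (-entropyBound θ N p.1.card) * Real.exp (-entropyBound θ N p.2.card)) :=
          Finset.sum_le_sum hT
      _ ≤ ∑ p ∈ Q ×ˢ Q, 2 * c *
          (Real.exp (-entropyBound θ N p.1.card) * Real.exp (-entropyBound θ N p.2.card)) :=
          Finset.sum_le_sum_of_subset_of_nonneg (Finset.filter_subset _ _)
            fun _ _ _ => by positivity
      _ = 2 * c * ((∑ A ∈ Q, Real.exp (-entropyBound θ N A.card)) *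
            ∑ A ∈ Q, Real.exp (-entropyBound θ N A.card)) := by
          rw [Finset.sum_product, Finset.sum_mul_sum, Finset.mul_sum]
          simp only [Finset.mul_sum]
      _ ≤ 2 * c * ((1 / 3) * (1 / 3)) := by gcongr
      _ < c := by linarith
      _ = _ := by simp [hc]
  obtain ⟨ε, hε⟩ := exists_forall_lt_one_of_sum_lt P (fun p ε => T p.1 p.2 ε)
    (fun p ε => hTnn p.1 p.2 ε) hsum
  refine ⟨ε, fun A B hAB hA hB hcard => hε (A, B) ?_⟩
  simp only [P, Q, Finset.mem_filter, Finset.mem_product, Finset.mem_univ, true_and]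
  exact ⟨⟨hA, hB⟩, hAB, hcard⟩

/-- There is a sign matrix whose block sums satisfy the sub-Gaussian bound conditional on the
smaller block, simultaneously for all pairs of disjoint blocks. -/
theorem exists_signMatrix {θ : ℝ} (hθ : 0 < θ) (hθ1 : θ ≤ 1) (N m : ℕ) :
    ∃ ε : SignMatrix N m, ∀ A B : Finset (Fin N), Disjoint A B → A.Nonempty → B.Nonempty →
      B.card ≤ A.card → |∑ i ∈ A, ∑ l ∈ B, gram ε i l| ≤
        2 * √(∑ k, rowSum ε B k ^ 2) * √(A.card * entropyBound θ N A.card) := by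
  obtain ⟨ε, hε⟩ := exists_signMatrix_exp hθ hθ1 N m
  refine ⟨ε, fun A B hAB hA hB hcard => ?_⟩
  have h1 := hε A B hAB hA hB hcard
  have hAc : (0 : ℝ) < A.card := by exact_mod_cast hA.card_pos
  have hN : 0 < N := by
    obtain ⟨i, _⟩ := hA
    exact i.pos
  have hL : 0 < entropyBound θ N A.card := entropyBound_pos hθ hN hA.card_pos
  have hS : ∑ i ∈ A, ∑ l ∈ B, gram ε i l = √(∑ k, rowSum ε B k ^ 2) * (∑ i ∈ A, ∑ k, ((ε (i, k) : ℤ) : ℝ) *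
          (rowSum ε B k / √(∑ k, rowSum ε B k ^ 2))) := by
    rw [sum_gram]
    simp only [Finset.mul_sum]
    refine Finset.sum_congr rfl fun i _ => Finset.sum_congr rfl fun k _ => ?_
    rcases eq_or_ne (√(∑ k, rowSum ε B k ^ 2)) 0 with h0 | h0
    · have hz : ∑ k, rowSum ε B k ^ 2 = 0 :=
        (Real.sqrt_eq_zero (Finset.sum_nonneg fun k _ => sq_nonneg _)).1 h0
      have := (Finset.sum_eq_zero_iff_of_nonneg (fun k _ => sq_nonneg _)).1 hz k
        (Finset.mem_univ k)
      rw [pow_eq_zero_iff two_ne_zero] at this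
      simp [this, h0]
    · field_simp
  rw [hS, abs_mul, abs_of_nonneg (Real.sqrt_nonneg _)]
  generalize (∑ i ∈ A, ∑ k, ((ε (i, k) : ℤ) : ℝ) *
          (rowSum ε B k / √(∑ k, rowSum ε B k ^ 2))) = S at h1 ⊢
  generalize entropyBound θ N A.card = L at h1 hL ⊢
  generalize (A.card : ℝ) = s at h1 hAc ⊢
  have hapos : 0 < 2 * √(L / s) := by
    have : 0 < √(L / s) := Real.sqrt_pos.2 (div_pos hL hAc)
    positivity
  have haL : 2 * √(L / s) * √(s * L) = 2 * L := by
    rw [mul_assoc, ← Real.sqrt_mul (div_pos hL hAc).le]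
    congr 1
    rw [show L / s * (s * L) = L ^ 2 by field_simp]
    exact Real.sqrt_sq hL.le
  generalize 2 * √(L / s) = a at h1 hapos haL
  have hlt : ∀ x : ℝ, Real.exp x * Real.exp (-4 * L) < 1 → x < 4 * L := by
    intro x hx
    rw [← Real.exp_add, Real.exp_lt_one_iff] at hx
    linarith
  have h2 : a * |S| < 4 * L := by
    rw [← abs_of_pos hapos, ← abs_mul, abs_lt]
    have h3 : 0 < Real.exp (a * S) * Real.exp (-4 * L) := by positivity
    have h4 : 0 < Real.exp (-a * S) * Real.exp (-4 * L) := by positivity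
    rw [add_mul] at h1
    have h6 := hlt _ (by linarith : Real.exp (a * S) * _ < 1)
    have h7 := hlt _ (by linarith : Real.exp (-a * S) * _ < 1)
    constructor <;> linarith
  have h8 : |S| ≤ 2 * √(s * L) := by
    refine le_of_mul_le_mul_left (a := a) ?_ hapos
    linarith
  have := mul_le_mul_of_nonneg_left h8 (Real.sqrt_nonneg (∑ k, rowSum ε B k ^ 2))
  linarith

/-- Decoupling: off-diagonal block sums are controlled by sums over disjoint blocks. -/
theorem abs_sum_offDiag_le {N : ℕ} (M : Fin N → Fin N → ℝ) (A B : Finset (Fin N)) (H : ℝ)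
    (h : ∀ A' ⊆ A, ∀ B' ⊆ B, Disjoint A' B' → |∑ i ∈ A', ∑ l ∈ B', M i l| ≤ H) :
    |∑ i ∈ A, ∑ l ∈ B, if i = l then 0 else M i l| ≤ 4 * H := by
  have hcount : ∀ i l : Fin N, 4 * ∑ I : Finset (Fin N), (if i ∈ I ∧ l ∉ I then M i l else 0) =
      2 ^ N * (if i = l then 0 else M i l) := by
    intro i l
    split_ifs with hil
    · subst hil
      simp
    · have hset : (Finset.univ.filter fun I : Finset (Fin N) => i ∈ I ∧ l ∉ I) =
          Finset.Icc {i} {l}ᶜ := by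
        ext I
        simp [Finset.subset_compl_singleton]
      rw [← Finset.sum_filter, Finset.sum_const, hset, Finset.card_Icc_finset (by simpa using Ne.symm hil),
        Finset.card_compl, Fintype.card_fin, Finset.card_singleton, Finset.card_singleton,
        nsmul_eq_mul, ← mul_assoc]
      congr 1
      have hN : 2 ≤ N := by
        have := i.2
        have := l.2
        have : (i : ℕ) ≠ l := fun h => hil (Fin.ext h)
        omega
      obtain ⟨n, rfl⟩ := Nat.exists_eq_add_of_le hN
      rw [show 2 + n - 1 - 1 = n by omega]
      push_cast
      rw [pow_add]
      norm_num
  have hsum : 2 ^ N * ∑ i ∈ A, ∑ l ∈ B, (if i = l then 0 else M i l) =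
      4 * ∑ I : Finset (Fin N), ∑ i ∈ A ∩ I, ∑ l ∈ B \ I, M i l := by
    have hI : ∀ I : Finset (Fin N), ∑ i ∈ A ∩ I, ∑ l ∈ B \ I, M i l =
        ∑ i ∈ A, ∑ l ∈ B, (if i ∈ I ∧ l ∉ I then M i l else 0) := by
      intro I
      rw [← Finset.filter_mem_eq_inter, Finset.sum_filter]
      refine Finset.sum_congr rfl fun i _ => ?_
      rw [← Finset.filter_notMem_eq_sdiff, Finset.sum_filter]
      by_cases hi : i ∈ I <;> simp [hi]
    have hswap : ∑ I : Finset (Fin N), ∑ i ∈ A, ∑ l ∈ B, (if i ∈ I ∧ l ∉ I then M i l else 0) =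
        ∑ i ∈ A, ∑ l ∈ B, ∑ I : Finset (Fin N), (if i ∈ I ∧ l ∉ I then M i l else 0) := by
      rw [Finset.sum_comm]
      exact Finset.sum_congr rfl fun i _ => Finset.sum_comm
    rw [Finset.sum_congr rfl fun I _ => hI I, hswap]
    simp only [Finset.mul_sum, ← hcount]
  have hbound : |∑ I : Finset (Fin N), ∑ i ∈ A ∩ I, ∑ l ∈ B \ I, M i l| ≤ 2 ^ N * H := by
    refine (Finset.abs_sum_le_sum_abs _ _).trans ?_
    refine (Finset.sum_le_sum fun I _ => h (A ∩ I) Finset.inter_subset_left (B \ I)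
      Finset.sdiff_subset ?_).trans ?_
    · exact Finset.disjoint_left.2 fun x hx hx' =>
        (Finset.mem_sdiff.1 hx').2 (Finset.mem_inter.1 hx).2
    · simp
  have hpos : (0 : ℝ) < 2 ^ N := by positivity
  refine le_of_mul_le_mul_left (a := (2 : ℝ) ^ N) ?_ hpos
  rw [← abs_of_pos hpos, ← abs_mul, abs_of_pos hpos, hsum, abs_mul, abs_of_pos four_pos]
  linarith

/-- The scale `√(s L(s))` for the entropy bound `L`. -/
noncomputable def entropyScale (θ : ℝ) (N s : ℕ) : ℝ := √(s * entropyBound θ N s)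

theorem entropyScale_mono {θ : ℝ} (hθ : 0 < θ) (hθ1 : θ ≤ 1) (N : ℕ) {r s : ℕ} (h : r ≤ s) :
    entropyScale θ N r ≤ entropyScale θ N s := by
  have := entropyBound_mono hθ hθ1 N h
  have h0 := entropyBound_nonneg hθ N r
  unfold entropyScale
  gcongr

theorem entropyScale_eq {θ : ℝ} (hθ : 0 < θ) (hθ1 : θ ≤ 1) (N s : ℕ) :
    entropyScale θ N s = √(4 + 1 / θ) * (s : ℝ) ^ (1 - θ / 2) * (N : ℝ) ^ (θ / 2) := by
  have h1 : (s : ℝ) * entropyBound θ N s =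
      (4 + 1 / θ) * ((s : ℝ) ^ (1 - θ / 2) * (N : ℝ) ^ (θ / 2)) ^ 2 := by
    have hs : ((s : ℝ) ^ (1 - θ / 2)) ^ 2 = s * (s : ℝ) ^ (1 - θ) := by
      rcases Nat.eq_zero_or_pos s with rfl | hs
      · rw [Nat.cast_zero, Real.zero_rpow (by linarith)]
        simp
      · have hs' : (0 : ℝ) < s := by exact_mod_cast hs
        rw [← Real.rpow_natCast, ← Real.rpow_mul hs'.le]
        nth_rewrite 2 [← Real.rpow_one (s : ℝ)]
        rw [← Real.rpow_add hs']
        congr 1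
        push_cast
        ring
    have hN : ((N : ℝ) ^ (θ / 2)) ^ 2 = (N : ℝ) ^ θ := by
      rw [← Real.rpow_natCast, ← Real.rpow_mul (Nat.cast_nonneg N)]
      congr 1
      push_cast
      ring
    rw [mul_pow, hs, hN, entropyBound]
    ring
  rw [entropyScale, h1, Real.sqrt_mul (by positivity), Real.sqrt_sq (by positivity), mul_assoc]

/-- Sub-Gaussian control of the block sums of the Gram matrix of `ε`. -/
def HasBlockBound (θ : ℝ) {N m : ℕ} (ε : SignMatrix N m) : Prop :=
  ∀ A B : Finset (Fin N), Disjoint A B → A.Nonempty → B.Nonempty →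
      B.card ≤ A.card → |∑ i ∈ A, ∑ l ∈ B, gram ε i l| ≤
        2 * √(∑ k, rowSum ε B k ^ 2) * √(A.card * entropyBound θ N A.card)

theorem HasBlockBound.abs_sum_le {θ : ℝ} (hθ : 0 < θ) (hθ1 : θ ≤ 1) {N m : ℕ}
    {ε : SignMatrix N m} (hε : HasBlockBound θ ε) {A B : Finset (Fin N)} (hAB : Disjoint A B)
    (hcard : B.card ≤ A.card) {x : ℝ} (hx : √(∑ k, rowSum ε B k ^ 2) ≤ x) {s : ℕ}
    (hs : A.card ≤ s) :
    |∑ i ∈ A, ∑ l ∈ B, gram ε i l| ≤ 2 * x * entropyScale θ N s := by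
  have hx0 : 0 ≤ x := (Real.sqrt_nonneg _).trans hx
  have hs0 : 0 ≤ entropyScale θ N s := Real.sqrt_nonneg _
  rcases A.eq_empty_or_nonempty with rfl | hA
  · simp only [Finset.sum_empty, abs_zero]; positivity
  rcases B.eq_empty_or_nonempty with rfl | hB
  · simp only [Finset.sum_empty, Finset.sum_const_zero, abs_zero]; positivity
  refine (hε A B hAB hA hB hcard).trans ?_
  have := entropyScale_mono hθ hθ1 N hs
  change _ * entropyScale θ N A.card ≤ _
  have h0 : 0 ≤ entropyScale θ N A.card := Real.sqrt_nonneg _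
  gcongr

theorem sum_gram_swap {N m : ℕ} (ε : SignMatrix N m) (A B : Finset (Fin N)) :
    ∑ i ∈ A, ∑ l ∈ B, gram ε i l = ∑ i ∈ B, ∑ l ∈ A, gram ε i l := by
  rw [Finset.sum_comm]
  exact Finset.sum_congr rfl fun i _ => Finset.sum_congr rfl fun l _ => gram_comm ε l i

theorem HasBlockBound.sqrt_rowSum_le {θ : ℝ} (hθ : 0 < θ) (hθ1 : θ ≤ 1) {N m : ℕ}
    {ε : SignMatrix N m} (hε : HasBlockBound θ ε) (B : Finset (Fin N)) {r : ℕ}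
    (hr : B.card ≤ r) :
    √(∑ k, rowSum ε B k ^ 2) ≤ √m * √r + 8 * entropyScale θ N r := by
  obtain ⟨B₀, hB₀, hmax⟩ := Finset.exists_max_image
    (Finset.univ.filter fun B : Finset (Fin N) => B.card ≤ r)
    (fun B => √(∑ k, rowSum ε B k ^ 2)) ⟨B, by simpa using hr⟩
  refine (hmax B (by simpa using hr)).trans ?_
  have hB₀r : B₀.card ≤ r := by simpa using hB₀
  have hle : ∀ A ⊆ B₀, √(∑ k, rowSum ε A k ^ 2) ≤ √(∑ k, rowSum ε B₀ k ^ 2) := by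
    intro A hA
    exact hmax A (by simpa using (Finset.card_le_card hA).trans hB₀r)
  have hdec := abs_sum_offDiag_le (gram ε) B₀ B₀
    (2 * √(∑ k, rowSum ε B₀ k ^ 2) * entropyScale θ N r) (by
      intro A' hA' B' hB' hd
      rcases le_total B'.card A'.card with h | h
      · exact hε.abs_sum_le hθ hθ1 hd h (hle B' hB') ((Finset.card_le_card hA').trans hB₀r)
      · rw [sum_gram_swap]
        exact hε.abs_sum_le hθ hθ1 hd.symm h (hle A' hA') ((Finset.card_le_card hB').trans hB₀r))
  have hsplit : ∑ k, rowSum ε B₀ k ^ 2 =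
      m * B₀.card + ∑ i ∈ B₀, ∑ l ∈ B₀, if i = l then 0 else gram ε i l := by
    rw [← sum_gram_self]
    have : ∀ i ∈ B₀, ∑ l ∈ B₀, gram ε i l =
        m + ∑ l ∈ B₀, if i = l then 0 else gram ε i l := by
      intro i hi
      rw [← Finset.add_sum_erase _ _ hi, ← Finset.add_sum_erase _ (fun l => if i = l then 0 else _) hi,
        gram_self, if_pos rfl, zero_add]
      congr 1
      refine Finset.sum_congr rfl fun l hl => ?_
      rw [if_neg (Finset.ne_of_mem_erase hl).symm]
    rw [Finset.sum_congr rfl this, Finset.sum_add_distrib]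
    simp [mul_comm]
  have hsq : √(∑ k, rowSum ε B₀ k ^ 2) ^ 2 = ∑ k, rowSum ε B₀ k ^ 2 :=
    Real.sq_sqrt (Finset.sum_nonneg fun k _ => sq_nonneg _)
  have hx0 := Real.sqrt_nonneg (∑ k, rowSum ε B₀ k ^ 2)
  have hΛ : 0 ≤ entropyScale θ N r := Real.sqrt_nonneg _
  have hmr : (m : ℝ) * B₀.card ≤ (√m * √r) ^ 2 := by
    rw [mul_pow, Real.sq_sqrt (Nat.cast_nonneg _), Real.sq_sqrt (Nat.cast_nonneg _)]
    have : (B₀.card : ℝ) ≤ r := by exact_mod_cast hB₀r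
    gcongr
  have hy : 0 ≤ √(m : ℝ) * √(r : ℝ) := by positivity
  have hoff := (le_abs_self _).trans hdec
  rw [← hsq] at hsplit
  generalize √(∑ k, rowSum ε B₀ k ^ 2) = x at *
  generalize √(m : ℝ) * √(r : ℝ) = y at *
  by_contra! hcon
  nlinarith [mul_nonneg hy hΛ]

theorem HasBlockBound.abs_sum_offDiag_gram_le {θ : ℝ} (hθ : 0 < θ) (hθ1 : θ ≤ 1) {N m : ℕ}
    {ε : SignMatrix N m} (hε : HasBlockBound θ ε) (A B : Finset (Fin N)) :
    |∑ i ∈ A, ∑ l ∈ B, if i = l then 0 else gram ε i l| ≤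
      8 * ((√m * √B.card + 8 * entropyScale θ N B.card) * entropyScale θ N A.card +
        (√m * √A.card + 8 * entropyScale θ N A.card) * entropyScale θ N B.card) := by
  have hA0 : 0 ≤ entropyScale θ N A.card := Real.sqrt_nonneg _
  have hB0 : 0 ≤ entropyScale θ N B.card := Real.sqrt_nonneg _
  have h1 : 0 ≤ (√m * √B.card + 8 * entropyScale θ N B.card) * entropyScale θ N A.card := by
    positivity
  have h2 : 0 ≤ (√m * √A.card + 8 * entropyScale θ N A.card) * entropyScale θ N B.card := by
    positivity
  have hdec := abs_sum_offDiag_le (gram ε) A B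
    (2 * ((√m * √B.card + 8 * entropyScale θ N B.card) * entropyScale θ N A.card +
        (√m * √A.card + 8 * entropyScale θ N A.card) * entropyScale θ N B.card)) (by
      intro A' hA' B' hB' hd
      rcases le_total B'.card A'.card with h | h
      · have := hε.abs_sum_le hθ hθ1 hd h
          (hε.sqrt_rowSum_le hθ hθ1 B' (Finset.card_le_card hB')) (Finset.card_le_card hA')
        linarith
      · rw [sum_gram_swap]
        have := hε.abs_sum_le hθ hθ1 hd.symm h
          (hε.sqrt_rowSum_le hθ hθ1 A' (Finset.card_le_card hA')) (Finset.card_le_card hB')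
        linarith)
  linarith

theorem sum_rpow_le_of_sum_le {ι : Type*} [DecidableEq ι] (f : ι → ℝ) (hf : ∀ i, 0 ≤ f i)
    (d : ℕ → ℝ) {τ : ℝ} (hτ : 0 ≤ τ) (h : ∀ B : Finset ι, ∑ i ∈ B, f i ≤ B.card * d B.card)
    (S : Finset ι) : ∑ i ∈ S, f i ^ τ ≤ ∑ k ∈ Finset.range S.card, d (k + 1) ^ τ := by
  induction hn : S.card generalizing S with
  | zero => simp [Finset.card_eq_zero.1 hn]
  | succ n ih =>
    obtain ⟨i, hi, hmin⟩ := S.exists_min_image f (Finset.card_pos.1 (by omega))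
    have h1 : f i ≤ d (n + 1) := by
      have h2 : S.card * f i ≤ ∑ j ∈ S, f j := by
        rw [← nsmul_eq_mul]
        exact Finset.card_nsmul_le_sum _ _ _ hmin
      have h3 := h2.trans (h S)
      rw [hn] at h3
      exact le_of_mul_le_mul_left h3 (by positivity)
    rw [Finset.sum_range_succ, ← Finset.sum_erase_add _ _ hi]
    exact add_le_add (ih _ (by rw [Finset.card_erase_of_mem hi, hn]; rfl))
      (Real.rpow_le_rpow (hf i) h1 hτ)

theorem sum_abs_le_of_abs_sum_le {ι : Type*} (S : Finset ι) (f : ι → ℝ) (H : ℝ)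
    (h : ∀ B ⊆ S, |∑ i ∈ B, f i| ≤ H) : ∑ i ∈ S, |f i| ≤ 2 * H := by
  classical
  rw [← Finset.sum_filter_add_sum_filter_not S (fun i => 0 ≤ f i), two_mul]
  refine add_le_add ?_ ?_
  · rw [Finset.sum_congr rfl fun i hi => abs_of_nonneg (Finset.mem_filter.1 hi).2]
    exact (le_abs_self _).trans (h _ (Finset.filter_subset _ _))
  · rw [Finset.sum_congr rfl fun i hi => abs_of_neg (not_le.1 (Finset.mem_filter.1 hi).2),
      Finset.sum_neg_distrib]
    exact (neg_le_abs _).trans (h _ (Finset.filter_subset _ _))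

theorem sum_norm_le_of_norm_sum_le {ι : Type*} (S : Finset ι) (g : ι → ℂ) (H : ℝ)
    (h : ∀ B ⊆ S, ‖∑ i ∈ B, g i‖ ≤ H) : ∑ i ∈ S, ‖g i‖ ≤ 4 * H := by
  have h1 := sum_abs_le_of_abs_sum_le S (fun i => (g i).re) H fun B hB => by
    rw [← Complex.re_sum]
    exact (Complex.abs_re_le_norm _).trans (h B hB)
  have h2 := sum_abs_le_of_abs_sum_le S (fun i => (g i).im) H fun B hB => by
    rw [← Complex.im_sum]
    exact (Complex.abs_im_le_norm _).trans (h B hB)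
  calc ∑ i ∈ S, ‖g i‖ ≤ ∑ i ∈ S, (|(g i).re| + |(g i).im|) :=
        Finset.sum_le_sum fun i _ => Complex.norm_le_abs_re_add_abs_im _
    _ ≤ 4 * H := by
        rw [Finset.sum_add_distrib]
        linarith

theorem sum_range_rpow_neg_half_le (N : ℕ) :
    ∑ k ∈ Finset.range N, ((k + 1 : ℕ) : ℝ) ^ (-(1 / 2) : ℝ) ≤ 2 * √N := by
  induction N with
  | zero => simp
  | succ n ih =>
    rw [Finset.sum_range_succ]
    have hpos : (0 : ℝ) < ((n + 1 : ℕ) : ℝ) := by positivity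
    rw [Real.rpow_neg hpos.le, ← Real.sqrt_eq_rpow]
    have hs : 0 < √((n + 1 : ℕ) : ℝ) := Real.sqrt_pos.2 hpos
    have h1 : √((n + 1 : ℕ) : ℝ) ^ 2 = (n : ℝ) + 1 := by
      rw [Real.sq_sqrt hpos.le]; push_cast; ring
    have h2 : √(n : ℝ) ^ 2 = n := Real.sq_sqrt (Nat.cast_nonneg n)
    have h3 := Real.sqrt_nonneg (n : ℝ)
    have h4 : (√((n + 1 : ℕ) : ℝ))⁻¹ ≤ 2 * √((n + 1 : ℕ) : ℝ) - 2 * √(n : ℝ) := by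
      rw [inv_le_iff_one_le_mul₀ hs]
      nlinarith [sq_nonneg (√((n + 1 : ℕ) : ℝ) - √(n : ℝ))]
    linarith

theorem Lp_const_mul {ι : Type*} (S : Finset ι) (u : ι → ℝ) (hu : ∀ i, 0 ≤ u i) {α τ : ℝ}
    (hα : 0 ≤ α) (hτ : 0 < τ) :
    (∑ i ∈ S, |α * u i| ^ τ) ^ (1 / τ) = α * (∑ i ∈ S, u i ^ τ) ^ (1 / τ) := by
  have h : ∀ i ∈ S, |α * u i| ^ τ = α ^ τ * u i ^ τ := fun i _ => by
    rw [abs_of_nonneg (mul_nonneg hα (hu i)), Real.mul_rpow hα (hu i)]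
  rw [Finset.sum_congr rfl h, ← Finset.mul_sum, Real.mul_rpow (by positivity)
    (Finset.sum_nonneg fun i _ => Real.rpow_nonneg (hu i) _), ← Real.rpow_mul hα,
    mul_one_div_cancel hτ.ne', Real.rpow_one]

/-- A restricted weak-type bound with a power gain implies an `ℓ_τ` bound. -/
theorem exists_Lp_le_of_norm_sum_le {τ : ℝ} (hτ : 2 < τ) :
    ∃ Z : ℝ, 0 < Z ∧ ∀ (N : ℕ) (g : Fin N → ℂ) (α β : ℝ), 0 ≤ α → 0 ≤ β →
      (∀ B : Finset (Fin N), ‖∑ i ∈ B, g i‖ ≤ α * (B.card : ℝ) ^ (1 - τ⁻¹ / 2) + β * √B.card) →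
      (∑ i, ‖g i‖ ^ τ) ^ (1 / τ) ≤ Z * (α * (N : ℝ) ^ (τ⁻¹ / 2) + β) := by
  have hτ0 : 0 < τ := by linarith
  set W : ℝ := ∑' k : ℕ, ((k : ℝ) ^ (τ / 2))⁻¹ with hW
  have hsum : Summable fun k : ℕ => ((k : ℝ) ^ (τ / 2))⁻¹ :=
    Real.summable_nat_rpow_inv.2 (by linarith)
  have hW0 : 0 ≤ W := tsum_nonneg fun k => by positivity
  refine ⟨4 * (2 + W ^ (1 / τ)), by positivity, fun N g α β hα hβ h => ?_⟩
  let u : ℕ → ℝ := fun k => ((k + 1 : ℕ) : ℝ) ^ (-(τ⁻¹ / 2))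
  let v : ℕ → ℝ := fun k => ((k + 1 : ℕ) : ℝ) ^ (-(1 / 2) : ℝ)
  have hu : ∀ k, 0 ≤ u k := fun k => by positivity
  have hv : ∀ k, 0 ≤ v k := fun k => by positivity
  have hmono : ∀ B C : Finset (Fin N), B ⊆ C → ‖∑ i ∈ B, g i‖ ≤
      α * (C.card : ℝ) ^ (1 - τ⁻¹ / 2) + β * √C.card := by
    intro B C hBC
    have hc : (B.card : ℝ) ≤ C.card := by exact_mod_cast Finset.card_le_card hBC
    have he : 0 ≤ 1 - τ⁻¹ / 2 := by
      have : τ⁻¹ ≤ 1 := inv_le_one_of_one_le₀ (by linarith)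
      linarith
    refine (h B).trans ?_
    gcongr
  have hmain := sum_rpow_le_of_sum_le (fun i => ‖g i‖) (fun i => norm_nonneg _)
    (fun k => 4 * (α * (k : ℝ) ^ (-(τ⁻¹ / 2)) + β * (k : ℝ) ^ (-(1 / 2) : ℝ))) hτ0.le (by
      intro B
      refine (sum_norm_le_of_norm_sum_le B g _ fun C hC => hmono C B hC).trans_eq ?_
      rcases Nat.eq_zero_or_pos B.card with h0 | h0
      · rw [h0, Nat.cast_zero, Real.zero_rpow, Real.sqrt_zero]
        · simp
        · have : τ⁻¹ ≤ 1 := inv_le_one_of_one_le₀ (by linarith)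
          linarith
      · have h0' : (0 : ℝ) < B.card := by exact_mod_cast h0
        have e1 : (B.card : ℝ) ^ (1 - τ⁻¹ / 2) = B.card * (B.card : ℝ) ^ (-(τ⁻¹ / 2)) := by
          rw [sub_eq_add_neg, Real.rpow_add h0', Real.rpow_one]
        have e2 : √(B.card : ℝ) = B.card * (B.card : ℝ) ^ (-(1 / 2) : ℝ) := by
          nth_rewrite 2 [← Real.rpow_one (B.card : ℝ)]
          rw [← Real.rpow_add h0', Real.sqrt_eq_rpow]
          norm_num
        rw [e1, e2]
        ring) Finset.univ
  rw [Finset.card_univ, Fintype.card_fin] at hmain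
  have hd : ∀ k, 4 * (α * ((k + 1 : ℕ) : ℝ) ^ (-(τ⁻¹ / 2)) +
      β * ((k + 1 : ℕ) : ℝ) ^ (-(1 / 2) : ℝ)) = |4 * α * u k + 4 * β * v k| := by
    intro k
    rw [abs_of_nonneg (by have := hu k; have := hv k; positivity)]
    simp only [u, v]
    ring
  have hmink := Real.Lp_add_le (Finset.range N) (fun k => 4 * α * u k) (fun k => 4 * β * v k)
    (by linarith : 1 ≤ τ)
  rw [Lp_const_mul _ _ hu (by positivity) hτ0, Lp_const_mul _ _ hv (by positivity) hτ0] at hmink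
  have hU : (∑ k ∈ Finset.range N, u k ^ τ) ^ (1 / τ) ≤ 2 * (N : ℝ) ^ (τ⁻¹ / 2) := by
    have e : ∀ k, u k ^ τ = ((k + 1 : ℕ) : ℝ) ^ (-(1 / 2) : ℝ) := fun k => by
      simp only [u]
      rw [← Real.rpow_mul (by positivity)]
      congr 1
      field_simp
    simp only [e]
    calc _ ≤ (2 * √(N : ℝ)) ^ (1 / τ) := by
          gcongr
          exact sum_range_rpow_neg_half_le N
      _ = (2 : ℝ) ^ (1 / τ) * (N : ℝ) ^ (τ⁻¹ / 2) := by
          rw [Real.mul_rpow (by norm_num) (Real.sqrt_nonneg _), Real.sqrt_eq_rpow,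
            ← Real.rpow_mul (Nat.cast_nonneg N)]
          congr 2
          field_simp
      _ ≤ 2 * (N : ℝ) ^ (τ⁻¹ / 2) := by
          gcongr
          nth_rewrite 2 [← Real.rpow_one (2 : ℝ)]
          apply Real.rpow_le_rpow_of_exponent_le (by norm_num)
          rw [div_le_one hτ0]
          linarith
  have hV : (∑ k ∈ Finset.range N, v k ^ τ) ^ (1 / τ) ≤ W ^ (1 / τ) := by
    have e : ∀ k, v k ^ τ = (((k + 1 : ℕ) : ℝ) ^ (τ / 2))⁻¹ := fun k => by
      simp only [v]
      rw [← Real.rpow_mul (by positivity), ← Real.rpow_neg (by positivity)]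
      congr 1
      ring
    simp only [e]
    gcongr
    rw [hW, hsum.tsum_eq_zero_add]
    have h1 := ((summable_nat_add_iff 1).2 hsum).sum_le_tsum (Finset.range N)
      fun k _ => by positivity
    have h2 : 0 ≤ (((0 : ℕ) : ℝ) ^ (τ / 2))⁻¹ := by positivity
    linarith
  have hW' : 0 ≤ W ^ (1 / τ) := by positivity
  have hNp : 0 ≤ (N : ℝ) ^ (τ⁻¹ / 2) := by positivity
  calc (∑ i, ‖g i‖ ^ τ) ^ (1 / τ)
      ≤ (∑ k ∈ Finset.range N, |4 * α * u k + 4 * β * v k| ^ τ) ^ (1 / τ) := by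
        refine Real.rpow_le_rpow (Finset.sum_nonneg fun i _ => by positivity) ?_ (by positivity)
        refine hmain.trans_eq (Finset.sum_congr rfl fun k _ => ?_)
        rw [hd]
    _ ≤ 4 * α * (2 * (N : ℝ) ^ (τ⁻¹ / 2)) + 4 * β * W ^ (1 / τ) :=
        hmink.trans (add_le_add (by gcongr) (by gcongr))
    _ ≤ _ := by
        have h1 : 0 ≤ α * (N : ℝ) ^ (τ⁻¹ / 2) * W ^ (1 / τ) := by positivity
        nlinarith

theorem norm_sum_mul_le_Lp {ι : Type*} (S : Finset ι) (x y : ι → ℂ) {p q : ℝ}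
    (hpq : p.HolderConjugate q) :
    ‖∑ i ∈ S, x i * y i‖ ≤ (∑ i ∈ S, ‖x i‖ ^ p) ^ (1 / p) * (∑ i ∈ S, ‖y i‖ ^ q) ^ (1 / q) := by
  have h := Real.inner_le_Lp_mul_Lq S (fun i => ‖x i‖) (fun i => ‖y i‖) hpq
  simp only [abs_norm] at h
  refine ((norm_sum_le _ _).trans_eq ?_).trans h
  exact Finset.sum_congr rfl fun i _ => norm_mul _ _

/-- The off-diagonal part of the Gram matrix of `ε`. -/
def offDiagGram {N m : ℕ} (ε : SignMatrix N m) (i l : Fin N) : ℝ :=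
  if i = l then 0 else gram ε i l

theorem offDiagGram_comm {N m : ℕ} (ε : SignMatrix N m) (i l : Fin N) :
    offDiagGram ε i l = offDiagGram ε l i := by
  simp [offDiagGram, gram_comm ε i l, eq_comm]

/-- The off-diagonal Gram matrix of suitable signs is bounded from `ℓ_{σ}^N` to `ℓ_{τ}^N`,
where `σ` is the exponent conjugate to `τ`. -/
theorem exists_offDiagGram_Lp_le {τ σ : ℝ} (hτ : 2 < τ) (hσ : σ.HolderConjugate τ) :
    ∃ K : ℝ, 0 < K ∧ ∀ N m : ℕ, (N : ℝ) ^ τ⁻¹ ≤ 2 * √m → ∃ ε : SignMatrix N m,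
      ∀ x : Fin N → ℂ, (∑ i, ‖∑ l, (offDiagGram ε i l : ℂ) * x l‖ ^ τ) ^ (1 / τ) ≤
        K * √m * (N : ℝ) ^ τ⁻¹ * (∑ i, ‖x i‖ ^ σ) ^ (1 / σ) := by
  obtain ⟨Z, hZ, hLp⟩ := exists_Lp_le_of_norm_sum_le hτ
  have hθ : 0 < τ⁻¹ := by positivity
  have hθ1 : τ⁻¹ ≤ 1 := inv_le_one_of_one_le₀ (by linarith)
  set c : ℝ := √(4 + 1 / τ⁻¹) with hc
  have hc0 : 0 < c := Real.sqrt_pos.2 (by positivity)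
  refine ⟨2 * Z * (8 * Z * (32 * c ^ 2 + c)), by positivity, fun N m hNm => ?_⟩
  obtain ⟨ε, hε⟩ := exists_signMatrix hθ hθ1 N m
  replace hε : HasBlockBound τ⁻¹ ε := hε
  refine ⟨ε, fun x => ?_⟩
  have hP : (N : ℝ) ^ τ⁻¹ = (N : ℝ) ^ (τ⁻¹ / 2) * (N : ℝ) ^ (τ⁻¹ / 2) := by
    rw [← Real.rpow_add_of_nonneg (Nat.cast_nonneg N) (by positivity) (by positivity), add_halves]
  have hP0 : 0 ≤ (N : ℝ) ^ (τ⁻¹ / 2) := by positivity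
  rw [hP] at hNm ⊢
  have hblock : ∀ B : Finset (Fin N),
      (∑ i, ‖((∑ l ∈ B, offDiagGram ε i l : ℝ) : ℂ)‖ ^ τ) ^ (1 / τ) ≤
        8 * Z * (32 * c ^ 2 + c) * √m * ((N : ℝ) ^ (τ⁻¹ / 2) * (N : ℝ) ^ (τ⁻¹ / 2) * √B.card +
          (N : ℝ) ^ (τ⁻¹ / 2) * (B.card : ℝ) ^ (1 - τ⁻¹ / 2)) := by
    intro B
    have hB0 : 0 ≤ entropyScale τ⁻¹ N B.card := Real.sqrt_nonneg _
    refine (hLp N _ (8 * (√m * √B.card + 16 * entropyScale τ⁻¹ N B.card) *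
      (c * (N : ℝ) ^ (τ⁻¹ / 2))) (8 * √m * entropyScale τ⁻¹ N B.card) (by positivity)
      (by positivity) ?_).trans ?_
    · intro A
      have h := hε.abs_sum_offDiag_gram_le hθ hθ1 A B
      rw [← Complex.ofReal_sum, Complex.norm_real, Real.norm_eq_abs]
      refine h.trans_eq ?_
      rw [entropyScale_eq hθ hθ1 N A.card, ← hc]
      ring
    · rw [entropyScale_eq hθ hθ1 N B.card, ← hc]
      have hm0 : 0 ≤ √(m : ℝ) := Real.sqrt_nonneg _
      have hr0 : 0 ≤ √(B.card : ℝ) := Real.sqrt_nonneg _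
      have hR0 : 0 ≤ (B.card : ℝ) ^ (1 - τ⁻¹ / 2) := by positivity
      generalize (N : ℝ) ^ (τ⁻¹ / 2) = P at *
      generalize √(m : ℝ) = M at *
      generalize √(B.card : ℝ) = r at *
      generalize (B.card : ℝ) ^ (1 - τ⁻¹ / 2) = R at *
      have h1 : 16 * c ^ 2 * R * P * (P * P) ≤ 16 * c ^ 2 * R * P * (2 * M) := by gcongr
      have h2 : 0 ≤ 32 * c ^ 2 * (M * (P * P) * r) := by positivity
      calc Z * (8 * (M * r + 16 * (c * R * P)) * (c * P) * P + 8 * M * (c * R * P))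
          = 8 * Z * (c * (M * (P * P) * r) + 16 * c ^ 2 * R * P * (P * P) + c * (M * R * P)) := by
            ring
        _ ≤ 8 * Z * ((32 * c ^ 2 * (M * (P * P) * r) + c * (M * (P * P) * r)) +
              16 * c ^ 2 * R * P * (2 * M) + c * (M * R * P)) := by
            refine mul_le_mul_of_nonneg_left ?_ (by positivity)
            linarith
        _ = _ := by ring
  set X : ℝ := (∑ i, ‖x i‖ ^ σ) ^ (1 / σ) with hX
  have hX0 : 0 ≤ X := by positivity
  set K₁ : ℝ := 8 * Z * (32 * c ^ 2 + c) with hK₁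
  have hK0 : 0 < K₁ := by positivity
  refine (hLp N _ (K₁ * √m * X * (N : ℝ) ^ (τ⁻¹ / 2))
    (K₁ * √m * X * ((N : ℝ) ^ (τ⁻¹ / 2) * (N : ℝ) ^ (τ⁻¹ / 2))) (by positivity) (by positivity)
    ?_).trans_eq (by ring)
  intro B
  have hswap : ∑ i ∈ B, ∑ l, (offDiagGram ε i l : ℂ) * x l =
      ∑ l, x l * ((∑ i ∈ B, offDiagGram ε l i : ℝ) : ℂ) := by
    rw [Finset.sum_comm]
    refine Finset.sum_congr rfl fun l _ => ?_
    rw [Complex.ofReal_sum, Finset.mul_sum]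
    exact Finset.sum_congr rfl fun i _ => by rw [offDiagGram_comm, mul_comm]
  rw [hswap]
  refine (norm_sum_mul_le_Lp _ _ _ hσ).trans
    ((mul_le_mul_of_nonneg_left (hblock B) hX0).trans_eq ?_)
  ring

theorem norm_toLp_le_of_exponent_le {ι : Type*} [Fintype ι] {p q : ℝ≥0∞} [Fact (1 ≤ p)]
    [Fact (1 ≤ q)] (h : p ≤ q) (x : ι → ℂ) : ‖WithLp.toLp q x‖ ≤ ‖WithLp.toLp p x‖ := by
  rcases eq_or_ne p ∞ with rfl | hp
  · obtain rfl := top_le_iff.1 h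
    exact le_rfl
  have hp0 : 0 < p.toReal :=
    ENNReal.toReal_pos (zero_lt_one.trans_le (Fact.out : 1 ≤ p)).ne' hp
  have hi : ∀ i, ‖x i‖ ≤ ‖WithLp.toLp p x‖ := fun i => PiLp.norm_apply_le (WithLp.toLp p x) i
  rcases eq_or_ne q ∞ with rfl | hq
  · rw [PiLp.norm_toLp]
    exact (pi_norm_le_iff_of_nonneg (norm_nonneg _)).2 hi
  have hpq : p.toReal ≤ q.toReal := ENNReal.toReal_mono hq h
  have hq0 : 0 < q.toReal := hp0.trans_le hpq
  have hn := norm_nonneg (WithLp.toLp p x)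
  have hpow : ‖WithLp.toLp p x‖ ^ p.toReal = ∑ i, ‖x i‖ ^ p.toReal := by
    rw [PiLp.norm_eq_sum hp0, ← Real.rpow_mul (by positivity), one_div_mul_cancel hp0.ne',
      Real.rpow_one]
  rw [PiLp.norm_eq_sum hq0, one_div, Real.rpow_inv_le_iff_of_pos (by positivity) hn hq0]
  calc ∑ i, ‖x i‖ ^ q.toReal
      ≤ ∑ i, ‖x i‖ ^ p.toReal * ‖WithLp.toLp p x‖ ^ (q.toReal - p.toReal) := by
        refine Finset.sum_le_sum fun i _ => ?_
        rw [← add_sub_cancel p.toReal q.toReal,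
          Real.rpow_add_of_nonneg (norm_nonneg _) hp0.le (sub_nonneg.2 hpq), add_sub_cancel]
        have := Real.rpow_le_rpow (norm_nonneg _) (hi i) (sub_nonneg.2 hpq)
        gcongr
    _ = ‖WithLp.toLp p x‖ ^ q.toReal := by
        rw [← Finset.sum_mul, ← hpow, ← Real.rpow_add_of_nonneg hn hp0.le (sub_nonneg.2 hpq),
          add_sub_cancel]

section ApproxNumber

variable {X Y : Type*} [NormedAddCommGroup X] [NormedSpace ℂ X] [NormedAddCommGroup Y]
  [NormedSpace ℂ Y]

theorem approxNumber_le_norm_sub (T A : X →L[ℂ] Y) {k : ℕ}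
    (hA : Module.rank ℂ (LinearMap.range (A : X →ₗ[ℂ] Y)) < (k : Cardinal)) :
    approxNumber T k ≤ ‖T - A‖ := by
  refine csInf_le ⟨0, ?_⟩ ⟨A, hA, rfl⟩
  rintro r ⟨B, -, rfl⟩
  exact norm_nonneg _

theorem approxNumber_nonneg (T : X →L[ℂ] Y) (k : ℕ) : 0 ≤ approxNumber T k := by
  refine Real.sInf_nonneg ?_
  rintro r ⟨B, -, rfl⟩
  exact norm_nonneg _

theorem approxNumber_le_norm (T : X →L[ℂ] Y) {k : ℕ} (hk : 1 ≤ k) : approxNumber T k ≤ ‖T‖ := by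
  have h0 : LinearMap.range ((0 : X →L[ℂ] Y) : X →ₗ[ℂ] Y) = ⊥ := LinearMap.range_eq_bot.2 rfl
  have := approxNumber_le_norm_sub T 0 (k := k) (by
    rw [h0, rank_bot]
    exact_mod_cast hk)
  rwa [sub_zero] at this

end ApproxNumber

section

variable (p₁ p₂ : ℝ≥0∞) [Fact (1 ≤ p₁)] [Fact (1 ≤ p₂)]

theorem lpId_apply (N : ℕ) (x : PiLp p₁ (fun _ : Fin N => ℂ)) :
    lpId p₁ p₂ N x = WithLp.toLp p₂ x.ofLp := rfl

theorem norm_lpId_le (h : p₁ ≤ p₂) (N : ℕ) : ‖lpId p₁ p₂ N‖ ≤ 1 := by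
  refine ContinuousLinearMap.opNorm_le_bound _ zero_le_one fun x => ?_
  rw [one_mul, lpId_apply]
  exact norm_toLp_le_of_exponent_le h x.ofLp

theorem approxNumber_lpId_eq_zero {N k : ℕ} (h : N < k) : approxNumber (lpId p₁ p₂ N) k = 0 := by
  refine le_antisymm ?_ (approxNumber_nonneg _ _)
  have hr : Module.rank ℂ (LinearMap.range (lpId p₁ p₂ N).toLinearMap) < (k : Cardinal) := by
    refine (rank_range_le _).trans_lt ?_
    rw [(WithLp.linearEquiv p₁ ℂ (Fin N → ℂ)).rank_eq, rank_fun', Fintype.card_fin]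
    exact_mod_cast h
  simpa using approxNumber_le_norm_sub (lpId p₁ p₂ N) _ hr

/-- Normalised Gram matrices of signs as approximations of the identity. -/
theorem approxNumber_lpId_le {N m k : ℕ} (hm : 0 < m) (hmk : m < k) (ε : SignMatrix N m) {D : ℝ}
    (hD : 0 ≤ D) (h : ∀ x : Fin N → ℂ,
      ‖WithLp.toLp p₂ (fun i => ∑ l, (offDiagGram ε i l : ℂ) * x l)‖ ≤ D * ‖WithLp.toLp p₁ x‖) :
    approxNumber (lpId p₁ p₂ N) k ≤ D / m := by
  have hmC : (m : ℂ) ≠ 0 := by exact_mod_cast hm.ne'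
  let U : Matrix (Fin N) (Fin m) ℂ := fun i k => ((ε (i, k) : ℤ) : ℂ)
  let f : PiLp p₁ (fun _ : Fin N => ℂ) →ₗ[ℂ] (Fin m → ℂ) :=
    U.transpose.mulVecLin.comp (WithLp.linearEquiv p₁ ℂ (Fin N → ℂ)).toLinearMap
  let g : (Fin m → ℂ) →ₗ[ℂ] PiLp p₂ (fun _ : Fin N => ℂ) :=
    (WithLp.linearEquiv p₂ ℂ (Fin N → ℂ)).symm.toLinearMap.comp ((m : ℂ)⁻¹ • U.mulVecLin)
  let A := LinearMap.toContinuousLinearMap (g.comp f)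
  have hrank : Module.rank ℂ (LinearMap.range A.toLinearMap) < (k : Cardinal) := by
    have h1 : LinearMap.rank (g.comp f) ≤ (m : Cardinal) := by
      refine (LinearMap.rank_comp_le_left f g).trans ((rank_range_le g).trans_eq ?_)
      rw [rank_fun', Fintype.card_fin]
    exact h1.trans_lt (by exact_mod_cast hmk)
  refine (approxNumber_le_norm_sub _ A hrank).trans ?_
  refine ContinuousLinearMap.opNorm_le_bound _ (by positivity) fun x => ?_
  have hgram : ∀ i, ∑ k, U i k * ∑ l, U l k * x.ofLp l =
      m * x.ofLp i + ∑ l, (offDiagGram ε i l : ℂ) * x.ofLp l := by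
    intro i
    have h1 : ∑ k, U i k * ∑ l, U l k * x.ofLp l = ∑ l, (gram ε i l : ℂ) * x.ofLp l := by
      simp only [Finset.mul_sum]
      rw [Finset.sum_comm]
      refine Finset.sum_congr rfl fun l _ => ?_
      simp only [gram, U]
      push_cast
      rw [Finset.sum_mul]
      exact Finset.sum_congr rfl fun k _ => by ring
    rw [h1, ← Finset.add_sum_erase _ _ (Finset.mem_univ i),
      ← Finset.add_sum_erase _ (fun l => (offDiagGram ε i l : ℂ) * x.ofLp l) (Finset.mem_univ i),
      gram_self]
    have h2 : offDiagGram ε i i = 0 := by simp [offDiagGram]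
    rw [h2]
    push_cast
    rw [zero_mul, zero_add]
    congr 1
    refine Finset.sum_congr rfl fun l hl => ?_
    rw [offDiagGram, if_neg (Finset.ne_of_mem_erase hl).symm]
  have hdiff : (lpId p₁ p₂ N - A) x = (-(m : ℂ)⁻¹) •
      WithLp.toLp p₂ (fun i => ∑ l, (offDiagGram ε i l : ℂ) * x.ofLp l) := by
    ext i
    change x.ofLp i - (m : ℂ)⁻¹ * (∑ k, U i k * ∑ l, U l k * x.ofLp l) =
      -(m : ℂ)⁻¹ * ∑ l, (offDiagGram ε i l : ℂ) * x.ofLp l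
    rw [hgram]
    field_simp
    ring
  rw [hdiff, norm_smul, norm_neg, norm_inv, Complex.norm_natCast]
  calc (m : ℝ)⁻¹ * _ ≤ (m : ℝ)⁻¹ * (D * ‖WithLp.toLp p₁ x.ofLp‖) := by
        gcongr
        exact h _
    _ = D / m * ‖x‖ := by
        rw [WithLp.toLp_ofLp]
        ring

end

/-- Embedding both exponents into the pair `(t', t)` reduces the bound to the off-diagonal Gram
matrix on `ℓ_{t'} → ℓ_t`. -/
theorem exists_approxNumber_lpId_le (p₁ p₂ t : ℝ≥0∞) [Fact (1 ≤ p₁)] [Fact (1 ≤ p₂)]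
    (h2t : 2 < t) (htop : t ≠ ∞) (ht₁ : t ≤ conjExp p₁) (ht₂ : t ≤ p₂) :
    ∃ K : ℝ, 0 < K ∧ ∀ N m k : ℕ, 0 < m → m < k → (N : ℝ) ^ t.toReal⁻¹ ≤ 2 * √m →
      approxNumber (lpId p₁ p₂ N) k ≤ K * √m * (N : ℝ) ^ t.toReal⁻¹ / m := by
  have hτ : 2 < t.toReal := by
    simpa using (ENNReal.toReal_lt_toReal (by simp) htop).2 h2t
  have htinv : t⁻¹ ≤ 1 := ENNReal.inv_le_one.2 (one_le_two.trans h2t.le)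
  have hreal : (conjExp t).toReal = (1 - t.toReal⁻¹)⁻¹ := by
    rw [conjExp, ENNReal.toReal_inv, ENNReal.toReal_sub_of_le htinv ENNReal.one_ne_top,
      ENNReal.toReal_one, ENNReal.toReal_inv]
  have hσ : (conjExp t).toReal.HolderConjugate t.toReal := by
    rw [Real.holderConjugate_iff, hreal, inv_inv, sub_add_cancel]
    have h1 : t.toReal⁻¹ < 1 := inv_lt_one_of_one_lt₀ (one_lt_two.trans hτ)
    have h0 : 0 < t.toReal⁻¹ := by positivity
    exact ⟨(one_lt_inv₀ (by linarith)).2 (by linarith), rfl⟩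
  have hp₁q : p₁ ≤ conjExp t := by
    rw [conjExp, ENNReal.le_inv_iff_le_inv] at ht₁ ⊢
    exact tsub_le_iff_tsub_le.1 ht₁
  have : Fact (1 ≤ t) := ⟨one_le_two.trans h2t.le⟩
  have : Fact (1 ≤ conjExp t) := ⟨(Fact.out : 1 ≤ p₁).trans hp₁q⟩
  obtain ⟨K, hK, H⟩ := exists_offDiagGram_Lp_le hτ hσ
  refine ⟨K, hK, fun N m k hm hmk hN => ?_⟩
  obtain ⟨ε, hε⟩ := H N m hN
  refine approxNumber_lpId_le p₁ p₂ hm hmk ε (by positivity) fun x => ?_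
  refine (norm_toLp_le_of_exponent_le ht₂ _).trans ?_
  calc _ ≤ K * √m * (N : ℝ) ^ t.toReal⁻¹ * ‖WithLp.toLp (conjExp t) x‖ := by
        rw [PiLp.norm_eq_sum hσ.symm.pos, PiLp.norm_eq_sum hσ.pos]
        exact hε x
    _ ≤ _ := by
        gcongr
        exact norm_toLp_le_of_exponent_le hp₁q x

/-- If `1 ≤ p₁ < 2 < p₂ ≤ ∞`, `(p₁, p₂) ≠ (1, ∞)` and `t = min(p₁′, p₂)`, then
`a_k(id : ℓ_{p₁}^N → ℓ_{p₂}^N) ≤ C` for `k ≤ N^{2/t}`,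
`a_k ≤ C N^{1/t} k^{-1/2}` for `N^{2/t} < k ≤ N`, and `a_k = 0` for `k > N`. -/
theorem stmt3 (p₁ p₂ : ℝ≥0∞) [Fact (1 ≤ p₁)] [Fact (1 ≤ p₂)]
    (h₁ : p₁ < 2) (h₂ : 2 < p₂) (hne : ¬(p₁ = 1 ∧ p₂ = ∞)) :
    ∃ C : ℝ, 0 < C ∧
      ∀ N k : ℕ, 1 ≤ k →
        ((k : ℝ) ≤ (N : ℝ) ^ (2 * (min (conjExp p₁) p₂)⁻¹.toReal) →
          approxNumber (lpId p₁ p₂ N) k ≤ C) ∧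
        ((N : ℝ) ^ (2 * (min (conjExp p₁) p₂)⁻¹.toReal) < (k : ℝ) → k ≤ N →
          approxNumber (lpId p₁ p₂ N) k
            ≤ C * (N : ℝ) ^ ((min (conjExp p₁) p₂)⁻¹.toReal) * (k : ℝ) ^ (-(1/2) : ℝ)) ∧
        (N < k → approxNumber (lpId p₁ p₂ N) k = 0) := by
  have h1p : 1 ≤ p₁ := Fact.out
  have hconj : 2 < conjExp p₁ := by
    rw [conjExp, ENNReal.lt_inv_iff_lt_inv]
    refine ENNReal.sub_lt_of_lt_add (ENNReal.inv_le_one.2 h1p) ?_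
    rw [← ENNReal.inv_two_add_inv_two]
    exact ENNReal.add_lt_add_left (by simp) (ENNReal.inv_lt_inv.2 h₁)
  have htop : min (conjExp p₁) p₂ ≠ ∞ := by
    intro h
    obtain ⟨ha, hb⟩ := min_eq_top.1 h
    refine hne ⟨le_antisymm ?_ h1p, hb⟩
    rw [conjExp, ENNReal.inv_eq_top, tsub_eq_zero_iff_le] at ha
    simpa using ha
  obtain ⟨K, hK, H⟩ := exists_approxNumber_lpId_le p₁ p₂ (min (conjExp p₁) p₂)
    (lt_min hconj h₂) htop (min_le_left _ _) (min_le_right _ _)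
  simp only [ENNReal.toReal_inv] at *
  generalize hθ : (min (conjExp p₁) p₂).toReal⁻¹ = θ at *
  have hθ0 : 0 ≤ θ := hθ ▸ inv_nonneg.2 ENNReal.toReal_nonneg
  refine ⟨1 + 2 * K, by positivity, fun N k hk => ⟨fun _ => ?_, fun hNk hkN => ?_,
    approxNumber_lpId_eq_zero p₁ p₂⟩⟩
  · have := (approxNumber_le_norm (lpId p₁ p₂ N) hk).trans (norm_lpId_le p₁ p₂ (h₁.trans h₂).le N)
    linarith
  · have hN1 : (1 : ℝ) ≤ N := by exact_mod_cast hk.trans hkN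
    have hNpow : (N : ℝ) ^ (2 * θ) = ((N : ℝ) ^ θ) ^ 2 := by
      rw [mul_comm, Real.rpow_mul (by positivity), Real.rpow_two]
    have hk1 : 1 < k := by
      exact_mod_cast (Real.one_le_rpow hN1 (by positivity)).trans_lt hNk
    obtain ⟨m, rfl⟩ : ∃ m, k = m + 1 := ⟨k - 1, by omega⟩
    have hm : 0 < m := by omega
    have hmR : (1 : ℝ) ≤ m := by exact_mod_cast hm
    have hsq : √((m + 1 : ℕ) : ℝ) ≤ 2 * √m := by
      rw [Real.sqrt_le_left (by positivity), mul_pow, Real.sq_sqrt (by positivity)]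
      push_cast
      linarith
    have hNle : (N : ℝ) ^ θ ≤ 2 * √m :=
      (Real.le_sqrt_of_sq_le (hNpow ▸ hNk.le)).trans hsq
    refine (H N m (m + 1) hm m.lt_succ_self hNle).trans ?_
    have hms : 0 < √(m : ℝ) := by positivity
    have hks : 0 < √((m + 1 : ℕ) : ℝ) := by positivity
    have hinv : (√(m : ℝ))⁻¹ ≤ 2 * (√((m + 1 : ℕ) : ℝ))⁻¹ := by
      rw [← div_eq_mul_inv, le_div_iff₀ hks, inv_mul_le_iff₀ hms, mul_comm]
      exact hsq
    have hdiv : √(m : ℝ) / m = (√(m : ℝ))⁻¹ := Real.sqrt_div_self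
    calc K * √m * (N : ℝ) ^ θ / m = K * (N : ℝ) ^ θ * (√(m : ℝ))⁻¹ := by
          rw [← hdiv]
          ring
      _ ≤ K * (N : ℝ) ^ θ * (2 * (√((m + 1 : ℕ) : ℝ))⁻¹) := by gcongr
      _ ≤ (1 + 2 * K) * (N : ℝ) ^ θ * (√((m + 1 : ℕ) : ℝ))⁻¹ := by
          have : 0 ≤ (N : ℝ) ^ θ * (√((m + 1 : ℕ) : ℝ))⁻¹ := by positivity
          linarith
      _ = _ := by rw [Real.rpow_neg (by positivity), ← Real.sqrt_eq_rpow]
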